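/- Let k be a field and H a left noetherian Hopf algebra over k with bijective antipode. Assume that the category of left-right Long dimodules over H satisfies condition (†), and that the coinvariants functor M ↦ M^{coH} on right H-comodules is exact. Then every Long dimodule M that is finitely generated as an H-module is a direct sum, in the category of Long dimodules, of a family of simple subobjects finitely generated as H-modules, and the category of Long dimodules over H is semisimple. -/

import Mathlib

/-!
Common definitions for formalizing "Semisimplicity of the categories of
Yetter-Drinfeld modules and Long dimodules" (Caenepeel, Guédénon).
-/

open TensorProduct

noncomputable section
namespace YDPaper

section RingPart

variable (k H : Type) [CommRing k] [Ring H] [HopfAlgebra k H]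

/-- `ρ : M →ₗ[k] M ⊗[k] H` is a (coassociative, counital) right `H`-comodule
structure on `M`. -/
def IsComod {M : Type} [AddCommGroup M] [Module k M] (ρ : M →ₗ[k] M ⊗[k] H) : Prop :=
  (∀ m : M, (TensorProduct.rid k M)
      ((LinearMap.lTensor M (Coalgebra.counit (R := k) (A := H))) (ρ m)) = m) ∧
  (∀ m : M, (TensorProduct.assoc k M H H) ((LinearMap.rTensor H ρ) (ρ m)) =
      (LinearMap.lTensor M (Coalgebra.comul (R := k) (A := H))) (ρ m))

/-- The iterated comultiplication `h ↦ (h₁ ⊗ h₂) ⊗ h₃`. -/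
def Delta2 : H →ₗ[k] (H ⊗[k] H) ⊗[k] H :=
  (LinearMap.rTensor H (Coalgebra.comul (R := k) (A := H))).comp
    (Coalgebra.comul (R := k) (A := H))

/-- The Yetter-Drinfeld compatibility condition
`ρ(h • m) = h₂ • m₀ ⊗ h₃ m₁ S⁻¹(h₁)`, expressed via arbitrary Sweedler
decompositions of `Δ²(h)` and `ρ(m)` into finite sums of pure tensors. -/
def IsYDCompat (Sinv : H →ₗ[k] H) {M : Type} [AddCommGroup M] [Module k M] [Module H M]
    (ρ : M →ₗ[k] M ⊗[k] H) : Prop :=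
  ∀ (h : H) (m : M) (s t : Finset ℕ) (a b c : ℕ → H) (m₀ : ℕ → M) (m₁ : ℕ → H),
    (∑ i ∈ s, (a i ⊗ₜ[k] b i) ⊗ₜ[k] c i) = Delta2 k H h →
    (∑ j ∈ t, m₀ j ⊗ₜ[k] m₁ j) = ρ m →
    ρ (h • m) = ∑ i ∈ s, ∑ j ∈ t, (b i • m₀ j) ⊗ₜ[k] (c i * m₁ j * Sinv (a i))

/-- The `k`-linear map `m ↦ h • m`. -/
def smulMap {M : Type} [AddCommGroup M] [Module k M] [Module H M] [SMulCommClass H k M]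
    (h : H) : M →ₗ[k] M where
  toFun m := h • m
  map_add' := smul_add h
  map_smul' c m := (smul_comm h c m)

/-- The Long dimodule compatibility condition `ρ(h • m) = h • m₀ ⊗ m₁`. -/
def IsLongCompat {M : Type} [AddCommGroup M] [Module k M] [Module H M] [SMulCommClass H k M]
    (ρ : M →ₗ[k] M ⊗[k] H) : Prop :=
  ∀ (h : H) (m : M), ρ (h • m) = (LinearMap.rTensor H (smulMap k H h)) (ρ m)

/-- Morphisms in the categories of Yetter-Drinfeld modules and of Long dimodules:
`H`-linear and `H`-colinear maps. -/
def IsHom {A B : Type} [AddCommGroup A] [Module k A] [Module H A]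
    [AddCommGroup B] [Module k B] [Module H B]
    (ρA : A →ₗ[k] A ⊗[k] H) (ρB : B →ₗ[k] B ⊗[k] H) (f : A →ₗ[k] B) : Prop :=
  (∀ (h : H) (a : A), f (h • a) = h • f a) ∧
  ρB.comp f = (LinearMap.rTensor H f).comp ρA

/-- `H`-colinearity of a `k`-linear map between right `H`-comodules. -/
def IsColin {A B : Type} [AddCommGroup A] [Module k A]
    [AddCommGroup B] [Module k B]
    (ρA : A →ₗ[k] A ⊗[k] H) (ρB : B →ₗ[k] B ⊗[k] H) (f : A →ₗ[k] B) : Prop :=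
  ρB.comp f = (LinearMap.rTensor H f).comp ρA

/-- A bundled left-right Yetter-Drinfeld module over `H` (with chosen inverse `Sinv`
of the antipode). -/
structure YDCat (Sinv : H →ₗ[k] H) where
  M : Type
  [iAdd : AddCommGroup M]
  [iModk : Module k M]
  [iModH : Module H M]
  [iTower : IsScalarTower k H M]
  [iComm : SMulCommClass H k M]
  ρ : M →ₗ[k] M ⊗[k] H
  comod : IsComod k H ρ
  compat : IsYDCompat k H Sinv ρ

attribute [instance] YDCat.iAdd YDCat.iModk YDCat.iModH YDCat.iTower YDCat.iComm

/-- A bundled left-right Long dimodule over `H`. -/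
structure LongCat where
  M : Type
  [iAdd : AddCommGroup M]
  [iModk : Module k M]
  [iModH : Module H M]
  [iTower : IsScalarTower k H M]
  [iComm : SMulCommClass H k M]
  ρ : M →ₗ[k] M ⊗[k] H
  comod : IsComod k H ρ
  compat : IsLongCompat k H ρ

attribute [instance] LongCat.iAdd LongCat.iModk LongCat.iModH LongCat.iTower LongCat.iComm

/-- A bundled right `H`-comodule. -/
structure ComodCat where
  V : Type
  [iAdd : AddCommGroup V]
  [iModk : Module k V]
  ρ : V →ₗ[k] V ⊗[k] H
  comod : IsComod k H ρ

attribute [instance] ComodCat.iAdd ComodCat.iModk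

section Subobjects

variable {k H}
variable {M : Type} [AddCommGroup M] [Module k M] [Module H M] [IsScalarTower k H M]

/-- A subobject in the category of Yetter-Drinfeld modules (or Long dimodules):
an `H`-submodule which is stable under the coaction, i.e. `ρ(p) ⊆ p ⊗ H`. -/
def IsSubobject (ρ : M →ₗ[k] M ⊗[k] H) (p : Submodule H M) : Prop :=
  ∀ m ∈ p, ρ m ∈ LinearMap.range (LinearMap.rTensor H (p.restrictScalars k).subtype)

/-- A simple subobject: a nonzero coaction-stable `H`-submodule with no proper
nonzero coaction-stable `H`-submodules. -/
def IsSimpleSubobject (ρ : M →ₗ[k] M ⊗[k] H) (p : Submodule H M) : Prop :=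
  IsSubobject ρ p ∧ p ≠ ⊥ ∧
    ∀ q : Submodule H M, IsSubobject ρ q → q ≤ p → q = ⊥ ∨ q = p

/-- `M` is the (internal) direct sum of a family of simple subobjects which are
finitely generated as `H`-modules. -/
def IsSemisimpleObj (ρ : M →ₗ[k] M ⊗[k] H) : Prop :=
  ∃ (ι : Type) (S : ι → Submodule H M),
    (∀ i, IsSimpleSubobject ρ (S i) ∧ (S i).FG) ∧
    iSupIndep S ∧ (⨆ i, S i) = ⊤

end Subobjects

section Subcomodules

variable {k H}
variable {V : Type} [AddCommGroup V] [Module k V]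

/-- A subcomodule: a `k`-submodule stable under the coaction. -/
def IsSubcomod (ρ : V →ₗ[k] V ⊗[k] H) (p : Submodule k V) : Prop :=
  ∀ v ∈ p, ρ v ∈ LinearMap.range (LinearMap.rTensor H p.subtype)

/-- A simple subcomodule. -/
def IsSimpleSubcomod (ρ : V →ₗ[k] V ⊗[k] H) (p : Submodule k V) : Prop :=
  IsSubcomod ρ p ∧ p ≠ ⊥ ∧
    ∀ q : Submodule k V, IsSubcomod ρ q → q ≤ p → q = ⊥ ∨ q = p

/-- A comodule is semisimple if it is the internal direct sum of a family of simple
subcomodules. -/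
def IsSemisimpleComod (ρ : V →ₗ[k] V ⊗[k] H) : Prop :=
  ∃ (ι : Type) (S : ι → Submodule k V),
    (∀ i, IsSimpleSubcomod ρ (S i)) ∧ iSupIndep S ∧ (⨆ i, S i) = ⊤

end Subcomodules

/-- `H` is cosemisimple: every right `H`-comodule is a direct sum of simple
subcomodules. -/
def Cosemisimple : Prop := ∀ C : ComodCat k H, IsSemisimpleComod C.ρ

section Coinv

variable {k H}
variable {A B : Type} [AddCommGroup A] [Module k A] [AddCommGroup B] [Module k B]

/-- The coinvariants `M^{co H} = { m | ρ m = m ⊗ 1 }` of a right `H`-comodule. -/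
def coinv (ρ : A →ₗ[k] A ⊗[k] H) : Submodule k A :=
  LinearMap.ker (ρ - (TensorProduct.mk k A H).flip 1)

lemma mem_coinv {ρ : A →ₗ[k] A ⊗[k] H} {a : A} :
    a ∈ coinv ρ ↔ ρ a = a ⊗ₜ[k] (1 : H) := by
  simp [coinv, LinearMap.mem_ker, sub_eq_zero]

/-- The map induced on coinvariants by an `H`-colinear map. -/
def coinvMap {ρA : A →ₗ[k] A ⊗[k] H} {ρB : B →ₗ[k] B ⊗[k] H} (f : A →ₗ[k] B)
    (hf : IsColin k H ρA ρB f) : ↥(coinv ρA) →ₗ[k] ↥(coinv ρB) :=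
  f.restrict (fun a ha => by
    have h1 : ρA a = a ⊗ₜ[k] (1 : H) := mem_coinv.1 ha
    have h2 : ρB (f a) = (LinearMap.rTensor H f) (ρA a) := by
      have := congrArg (fun (g : A →ₗ[k] B ⊗[k] H) => g a) hf
      simpa using this
    rw [mem_coinv, h2, h1, LinearMap.rTensor_tmul])

end Coinv

/-- Exactness of the coinvariants functor on the category of Yetter-Drinfeld
modules. -/
def CoinvExactYD (Sinv : H →ₗ[k] H) : Prop :=
  ∀ (A B C : YDCat k H Sinv) (f : A.M →ₗ[k] B.M) (g : B.M →ₗ[k] C.M)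
    (hf : IsHom k H A.ρ B.ρ f) (hg : IsHom k H B.ρ C.ρ g),
    Function.Injective f → Function.Surjective g →
    LinearMap.range f = LinearMap.ker g →
    Function.Injective (coinvMap f hf.2) ∧
    LinearMap.range (coinvMap f hf.2) = LinearMap.ker (coinvMap g hg.2) ∧
    Function.Surjective (coinvMap g hg.2)

/-- Exactness of the coinvariants functor on the category of right `H`-comodules. -/
def CoinvExactComod : Prop :=
  ∀ (A B C : ComodCat k H) (f : A.V →ₗ[k] B.V) (g : B.V →ₗ[k] C.V)
    (hf : IsColin k H A.ρ B.ρ f) (hg : IsColin k H B.ρ C.ρ g),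
    Function.Injective f → Function.Surjective g →
    LinearMap.range f = LinearMap.ker g →
    Function.Injective (coinvMap f hf) ∧
    LinearMap.range (coinvMap f hf) = LinearMap.ker (coinvMap g hg) ∧
    Function.Surjective (coinvMap g hg)

section Eval

variable {k H}
variable {M N : Type} [AddCommGroup M] [Module k M] [Module H M]
  [IsScalarTower k H M] [SMulCommClass H k M]
  [AddCommGroup N] [Module k N] [Module H N] [IsScalarTower k H N] [SMulCommClass H k N]

/-- Evaluation at `m` of `H`-linear maps, as a `k`-linear map. -/
def evalAtH (m : M) : (M →ₗ[H] N) →ₗ[k] N where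
  toFun f := f m
  map_add' _ _ := rfl
  map_smul' _ _ := rfl

/-- Evaluation at `m` of `k`-linear maps, as a `k`-linear map. -/
def evalAtK {V : Type} [AddCommGroup V] [Module k V] (v : V) :
    (V →ₗ[k] N) →ₗ[k] N where
  toFun f := f v
  map_add' _ _ := rfl
  map_smul' _ _ := rfl

/-- Contraction `N ⊗ H → N` along a functional `φ : H → k`. -/
def contract (φ : H →ₗ[k] k) : N ⊗[k] H →ₗ[k] N :=
  (TensorProduct.rid k N).toLinearMap.comp (LinearMap.lTensor N φ)

/-- Post-composition with an `H`-linear map, as a `k`-linear map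
`Hom_H(X, M) → Hom_H(X, N)`; here `X` is the (implicit) source. -/
def postcompH {X : Type} [AddCommGroup X] [Module k X] [Module H X]
    [IsScalarTower k H X] [SMulCommClass H k X]
    (f : M →ₗ[k] N) (hf : ∀ (h : H) (m : M), f (h • m) = h • f m) :
    (X →ₗ[H] M) →ₗ[k] (X →ₗ[H] N) where
  toFun φ :=
    { toFun := fun x => f (φ x)
      map_add' := fun x y => by simp
      map_smul' := fun h x => by simp [hf] }
  map_add' φ ψ := by ext x; simp
  map_smul' c φ := by ext x; simp

end Eval

/-- Condition (†) for the category of Yetter-Drinfeld modules: for every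
Yetter-Drinfeld module `X` which is finitely generated as a left `H`-module,
the functor `Hom_H(X, -)` is exact on the category of Yetter-Drinfeld modules. -/
def DaggerYD (Sinv : H →ₗ[k] H) : Prop :=
  ∀ X : YDCat k H Sinv, Module.Finite H X.M →
  ∀ (A B C : YDCat k H Sinv) (f : A.M →ₗ[k] B.M) (g : B.M →ₗ[k] C.M)
    (hf : IsHom k H A.ρ B.ρ f) (hg : IsHom k H B.ρ C.ρ g),
    Function.Injective f → Function.Surjective g →
    LinearMap.range f = LinearMap.ker g →
    Function.Injective (postcompH (X := X.M) f hf.1) ∧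
    LinearMap.range (postcompH (X := X.M) f hf.1) =
      LinearMap.ker (postcompH (X := X.M) g hg.1) ∧
    Function.Surjective (postcompH (X := X.M) g hg.1)

/-- Condition (†) for the category of Long dimodules. -/
def DaggerLong : Prop :=
  ∀ X : LongCat k H, Module.Finite H X.M →
  ∀ (A B C : LongCat k H) (f : A.M →ₗ[k] B.M) (g : B.M →ₗ[k] C.M)
    (hf : IsHom k H A.ρ B.ρ f) (hg : IsHom k H B.ρ C.ρ g),
    Function.Injective f → Function.Surjective g →
    LinearMap.range f = LinearMap.ker g →
    Function.Injective (postcompH (X := X.M) f hf.1) ∧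
    LinearMap.range (postcompH (X := X.M) f hf.1) =
      LinearMap.ker (postcompH (X := X.M) g hg.1) ∧
    Function.Surjective (postcompH (X := X.M) g hg.1)

/-- Projective object in the category of Yetter-Drinfeld modules. -/
def IsProjectiveYD (Sinv : H →ₗ[k] H) (P : YDCat k H Sinv) : Prop :=
  ∀ (A B : YDCat k H Sinv) (g : A.M →ₗ[k] B.M) (f : P.M →ₗ[k] B.M),
    IsHom k H A.ρ B.ρ g → Function.Surjective g → IsHom k H P.ρ B.ρ f →
    ∃ l : P.M →ₗ[k] A.M, IsHom k H P.ρ A.ρ l ∧ g.comp l = f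

/-- Projective object in the category of Long dimodules. -/
def IsProjectiveLong (P : LongCat k H) : Prop :=
  ∀ (A B : LongCat k H) (g : A.M →ₗ[k] B.M) (f : P.M →ₗ[k] B.M),
    IsHom k H A.ρ B.ρ g → Function.Surjective g → IsHom k H P.ρ B.ρ f →
    ∃ l : P.M →ₗ[k] A.M, IsHom k H P.ρ A.ρ l ∧ g.comp l = f

/-- Injective object in the category of Yetter-Drinfeld modules. -/
def IsInjectiveYD (Sinv : H →ₗ[k] H) (I : YDCat k H Sinv) : Prop :=
  ∀ (A B : YDCat k H Sinv) (ι : A.M →ₗ[k] B.M) (f : A.M →ₗ[k] I.M),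
    IsHom k H A.ρ B.ρ ι → Function.Injective ι → IsHom k H A.ρ I.ρ f →
    ∃ g : B.M →ₗ[k] I.M, IsHom k H B.ρ I.ρ g ∧ g.comp ι = f

/-- Projective object in the category of right `H`-comodules. -/
def IsProjectiveComod (P : ComodCat k H) : Prop :=
  ∀ (A B : ComodCat k H) (g : A.V →ₗ[k] B.V) (f : P.V →ₗ[k] B.V),
    IsColin k H A.ρ B.ρ g → Function.Surjective g → IsColin k H P.ρ B.ρ f →
    ∃ l : P.V →ₗ[k] A.V, IsColin k H P.ρ A.ρ l ∧ g.comp l = f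

section HomLemmas

variable {k H}
variable {A B C : Type} [AddCommGroup A] [Module k A] [Module H A]
  [AddCommGroup B] [Module k B] [Module H B]
  [AddCommGroup C] [Module k C] [Module H C]

lemma IsHom.comp' {ρA : A →ₗ[k] A ⊗[k] H} {ρB : B →ₗ[k] B ⊗[k] H} {ρC : C →ₗ[k] C ⊗[k] H}
    {f : A →ₗ[k] B} {g : B →ₗ[k] C}
    (hf : IsHom k H ρA ρB f) (hg : IsHom k H ρB ρC g) :
    IsHom k H ρA ρC (g.comp f) := by
  refine ⟨fun h a => by simp [LinearMap.comp_apply, hf.1, hg.1], ?_⟩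
  calc ρC.comp (g.comp f) = (ρC.comp g).comp f := by rw [LinearMap.comp_assoc]
    _ = ((LinearMap.rTensor H g).comp ρB).comp f := by rw [hg.2]
    _ = (LinearMap.rTensor H g).comp (ρB.comp f) := by rw [LinearMap.comp_assoc]
    _ = (LinearMap.rTensor H g).comp ((LinearMap.rTensor H f).comp ρA) := by rw [hf.2]
    _ = ((LinearMap.rTensor H g).comp (LinearMap.rTensor H f)).comp ρA := by
          rw [LinearMap.comp_assoc]
    _ = (LinearMap.rTensor H (g.comp f)).comp ρA := by rw [LinearMap.rTensor_comp]

end HomLemmas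

section HomYD

variable {k H}
variable (Sinv : H →ₗ[k] H)

/-- The `k`-module of morphisms of Yetter-Drinfeld modules `Hom_H^H(A, B)`, as a
submodule of the `k`-linear maps. -/
def homYD (A B : YDCat k H Sinv) : Submodule k (A.M →ₗ[k] B.M) where
  carrier := {f | IsHom k H A.ρ B.ρ f}
  add_mem' := by
    rintro f g ⟨hf1, hf2⟩ ⟨hg1, hg2⟩
    refine ⟨fun h a => by simp [hf1, hg1, smul_add], ?_⟩
    rw [LinearMap.comp_add, LinearMap.rTensor_add, LinearMap.add_comp, hf2, hg2]
  zero_mem' := by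
    refine ⟨fun h a => by simp, ?_⟩
    rw [LinearMap.comp_zero, LinearMap.rTensor_zero, LinearMap.zero_comp]
  smul_mem' := by
    rintro c f ⟨hf1, hf2⟩
    refine ⟨fun h a => by
      rw [LinearMap.smul_apply, LinearMap.smul_apply, hf1, smul_comm], ?_⟩
    rw [LinearMap.comp_smul, LinearMap.rTensor_smul, LinearMap.smul_comp, hf2]

/-- Post-composition with a morphism of Yetter-Drinfeld modules, as a `k`-linear map
between morphism spaces. -/
def postcompYD {X B C : YDCat k H Sinv}
    (g : B.M →ₗ[k] C.M) (hg : IsHom k H B.ρ C.ρ g) :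
    ↥(homYD Sinv X B) →ₗ[k] ↥(homYD Sinv X C) where
  toFun f := ⟨g.comp f.1, IsHom.comp' f.2 hg⟩
  map_add' f g' := by ext x; simp
  map_smul' c f := by ext x; simp

/-- An injective resolution `0 → X → I⁰ → I¹ → ⋯` in the category of
Yetter-Drinfeld modules. -/
structure IsInjRes (X : YDCat k H Sinv) (I : ℕ → YDCat k H Sinv)
    (ε : X.M →ₗ[k] (I 0).M) (d : ∀ n, (I n).M →ₗ[k] (I (n + 1)).M) : Prop where
  eps_hom : IsHom k H X.ρ (I 0).ρ ε
  d_hom : ∀ n, IsHom k H (I n).ρ (I (n + 1)).ρ (d n)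
  inj : ∀ n, IsInjectiveYD k H Sinv (I n)
  mono : Function.Injective ε
  exact0 : LinearMap.range ε = LinearMap.ker (d 0)
  exact : ∀ n, LinearMap.range (d n) = LinearMap.ker (d (n + 1))

/-- A projective resolution `⋯ → P₁ → P₀ → X → 0` in the category of
Yetter-Drinfeld modules. -/
structure IsProjRes (X : YDCat k H Sinv) (P : ℕ → YDCat k H Sinv)
    (ε : (P 0).M →ₗ[k] X.M) (d : ∀ n, (P (n + 1)).M →ₗ[k] (P n).M) : Prop where
  eps_hom : IsHom k H (P 0).ρ X.ρ ε
  d_hom : ∀ n, IsHom k H (P (n + 1)).ρ (P n).ρ (d n)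
  proj : ∀ n, IsProjectiveYD k H Sinv (P n)
  epi : Function.Surjective ε
  exact0 : LinearMap.range (d 0) = LinearMap.ker ε
  exact : ∀ n, LinearMap.range (d (n + 1)) = LinearMap.ker (d n)

/-- The projective dimension of `X` in the category of Yetter-Drinfeld modules is
at most `n`. -/
def pdimLE (X : YDCat k H Sinv) (n : ℕ) : Prop :=
  ∃ (P : ℕ → YDCat k H Sinv) (ε : (P 0).M →ₗ[k] X.M)
    (d : ∀ m, (P (m + 1)).M →ₗ[k] (P m).M),
    IsProjRes Sinv X P ε d ∧ ∀ i, n < i → Subsingleton (P i).M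

/-- The injective dimension of `X` in the category of Yetter-Drinfeld modules is
at most `n`. -/
def injdimLE (X : YDCat k H Sinv) (n : ℕ) : Prop :=
  ∃ (I : ℕ → YDCat k H Sinv) (ε : X.M →ₗ[k] (I 0).M)
    (d : ∀ m, (I m).M →ₗ[k] (I (m + 1)).M),
    IsInjRes Sinv X I ε d ∧ ∀ i, n < i → Subsingleton (I i).M

/-- The complex `Hom(X, I⁰) → Hom(X, I¹) → ⋯` of morphism spaces induced by a
cochain of Yetter-Drinfeld modules. -/
def homCx (X : YDCat k H Sinv) (I : ℕ → YDCat k H Sinv)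
    (d : ∀ n, (I n).M →ₗ[k] (I (n + 1)).M)
    (hd : ∀ n, IsHom k H (I n).ρ (I (n + 1)).ρ (d n)) (n : ℕ) :
    ↥(homYD Sinv X (I n)) →ₗ[k] ↥(homYD Sinv X (I (n + 1))) :=
  postcompYD Sinv (d n) (hd n)

/-- Coboundaries of the induced complex. -/
def boundaries (X : YDCat k H Sinv) (I : ℕ → YDCat k H Sinv)
    (d : ∀ n, (I n).M →ₗ[k] (I (n + 1)).M)
    (hd : ∀ n, IsHom k H (I n).ρ (I (n + 1)).ρ (d n)) :
    ∀ i, Submodule k ↥(homYD Sinv X (I i))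
  | 0 => ⊥
  | (i + 1) => LinearMap.range (homCx Sinv X I d hd i)

/-- The `i`-th cohomology (cocycles modulo coboundaries) of the complex
`Hom(X, I⁰) → Hom(X, I¹) → ⋯`; when `I` is an injective resolution of `Y`, this is
`Ext^i(X, Y)`, the `i`-th right derived functor of `Hom_H^H(X, -)`, in the category
of Yetter-Drinfeld modules. -/
abbrev cohomology (X : YDCat k H Sinv) (I : ℕ → YDCat k H Sinv)
    (d : ∀ n, (I n).M →ₗ[k] (I (n + 1)).M)
    (hd : ∀ n, IsHom k H (I n).ρ (I (n + 1)).ρ (d n)) (i : ℕ) : Type :=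
  ↥(Submodule.map (boundaries Sinv X I d hd i).mkQ
      (LinearMap.ker (homCx Sinv X I d hd i)))

end HomYD

section CharProps

variable {k H}
variable (Sinv : H →ₗ[k] H)

/-- Characterizing property of the coaction on `Hom_H(A, B)` for Yetter-Drinfeld
modules `A`, `B`: it is determined by `f₀(m) ⊗ f₁ = f(m₀)₀ ⊗ f(m₀)₁ S(m₁)`. -/
def HomCoactChar (A B : YDCat k H Sinv)
    (ρQ : (A.M →ₗ[H] B.M) →ₗ[k] (A.M →ₗ[H] B.M) ⊗[k] H) : Prop :=
  ∀ (f : A.M →ₗ[H] B.M) (m : A.M) (t : Finset ℕ) (m₀ : ℕ → A.M) (m₁ : ℕ → H),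
    (∑ j ∈ t, m₀ j ⊗ₜ[k] m₁ j) = A.ρ m →
    (LinearMap.rTensor H (evalAtH (N := B.M) m)) (ρQ f) =
      ∑ j ∈ t, (LinearMap.lTensor B.M
          (LinearMap.mulRight k (HopfAlgebra.antipode (R := k) (A := H) (m₁ j))))
        (B.ρ (f (m₀ j)))

/-- Characterizing property of the coaction on `Hom_k(V, B)` for a comodule `V` and
a Yetter-Drinfeld module `B`: `g₀(v) ⊗ g₁ = g(v₀)₀ ⊗ g(v₀)₁ S(v₁)`. -/
def HomKCoactChar (V : ComodCat k H) (B : YDCat k H Sinv)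
    (ρ' : (V.V →ₗ[k] B.M) →ₗ[k] (V.V →ₗ[k] B.M) ⊗[k] H) : Prop :=
  ∀ (g : V.V →ₗ[k] B.M) (v : V.V) (t : Finset ℕ) (v₀ : ℕ → V.V) (v₁ : ℕ → H),
    (∑ j ∈ t, v₀ j ⊗ₜ[k] v₁ j) = V.ρ v →
    (LinearMap.rTensor H (evalAtK (N := B.M) v)) (ρ' g) =
      ∑ j ∈ t, (LinearMap.lTensor B.M
          (LinearMap.mulRight k (HopfAlgebra.antipode (R := k) (A := H) (v₁ j))))
        (B.ρ (g (v₀ j)))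

/-- Characterizing property of the Yetter-Drinfeld coaction on `H ⊗ V`:
`ρ(h ⊗ v) = h₂ ⊗ v₀ ⊗ h₃ v₁ S⁻¹(h₁)`. -/
def HTensorYDChar (V : ComodCat k H)
    (ρT : (H ⊗[k] V.V) →ₗ[k] (H ⊗[k] V.V) ⊗[k] H) : Prop :=
  ∀ (h : H) (v : V.V) (s t : Finset ℕ) (a b c : ℕ → H) (v₀ : ℕ → V.V) (v₁ : ℕ → H),
    (∑ i ∈ s, (a i ⊗ₜ[k] b i) ⊗ₜ[k] c i) = Delta2 k H h →
    (∑ j ∈ t, v₀ j ⊗ₜ[k] v₁ j) = V.ρ v →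
    ρT (h ⊗ₜ[k] v) =
      ∑ i ∈ s, ∑ j ∈ t, (b i ⊗ₜ[k] v₀ j) ⊗ₜ[k] (c i * v₁ j * Sinv (a i))

/-- Characterizing property of the Long dimodule coaction on `H ⊗ V`:
`ρ(h ⊗ v) = h ⊗ v₀ ⊗ v₁`. -/
def HTensorLongChar (V : ComodCat k H)
    (ρT : (H ⊗[k] V.V) →ₗ[k] (H ⊗[k] V.V) ⊗[k] H) : Prop :=
  ∀ (h : H) (v : V.V) (t : Finset ℕ) (v₀ : ℕ → V.V) (v₁ : ℕ → H),
    (∑ j ∈ t, v₀ j ⊗ₜ[k] v₁ j) = V.ρ v →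
    ρT (h ⊗ₜ[k] v) = ∑ j ∈ t, (h ⊗ₜ[k] v₀ j) ⊗ₜ[k] v₁ j

end CharProps

end RingPart

section CommPart

variable {k H : Type} [CommRing k] [CommRing H] [HopfAlgebra k H] (Sinv : H →ₗ[k] H)

/-- Characterizing property of the Yetter-Drinfeld coaction on `M ⊗_H N`:
`ρ(m ⊗ n) = m₀ ⊗ n₀ ⊗ n₁ m₁` (for `H` commutative). -/
def TensorCoactChar (A B : YDCat k H Sinv)
    (ρT : (A.M ⊗[H] B.M) →ₗ[k] (A.M ⊗[H] B.M) ⊗[k] H) : Prop :=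
  ∀ (m : A.M) (n : B.M) (s t : Finset ℕ) (m₀ : ℕ → A.M) (m₁ : ℕ → H)
    (n₀ : ℕ → B.M) (n₁ : ℕ → H),
    (∑ i ∈ s, m₀ i ⊗ₜ[k] m₁ i) = A.ρ m →
    (∑ j ∈ t, n₀ j ⊗ₜ[k] n₁ j) = B.ρ n →
    ρT (m ⊗ₜ[H] n) =
      ∑ i ∈ s, ∑ j ∈ t, (m₀ i ⊗ₜ[H] n₀ j) ⊗ₜ[k] (n₁ j * m₁ i)

/-- Restriction along `v ↦ 1 ⊗ v`, i.e. the canonical map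
`Hom_H(H ⊗ V, N) → Hom_k(V, N)`, `f ↦ (v ↦ f(1 ⊗ v))`. -/
def resUnitMap (V : Type) [AddCommGroup V] [Module k V] (N : Type) [AddCommGroup N]
    [Module k N] [Module H N] [IsScalarTower k H N] [SMulCommClass H k N] :
    ((H ⊗[k] V) →ₗ[H] N) →ₗ[k] (V →ₗ[k] N) where
  toFun f := (f.restrictScalars k).comp ((TensorProduct.mk k H V) 1)
  map_add' f g := by ext v; rfl
  map_smul' c f := by ext v; rfl

end CommPart

section Helpers

open Coalgebra HopfAlgebra

variable {k H : Type} [Field k] [Ring H] [HopfAlgebra k H]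

/-- contraction of the right tensor factor -/
def con {V W : Type} [AddCommGroup V] [Module k V] [AddCommGroup W] [Module k W]
    (φ : W →ₗ[k] k) : V ⊗[k] W →ₗ[k] V :=
  (TensorProduct.rid k V).toLinearMap.comp (LinearMap.lTensor V φ)

section con
variable {V V' W : Type} [AddCommGroup V] [Module k V] [AddCommGroup V'] [Module k V']
  [AddCommGroup W] [Module k W]

lemma con_tmul (φ : W →ₗ[k] k) (v : V) (w : W) : con φ (v ⊗ₜ[k] w) = φ w • v := by
  simp [con]

lemma con_nat (φ : W →ₗ[k] k) (e : V →ₗ[k] V') (t : V ⊗[k] W) :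
    con φ (LinearMap.rTensor W e t) = e (con φ t) := by
  induction t with
  | zero => simp
  | tmul v w => simp [con_tmul]
  | add x y hx hy => simp [hx, hy]

lemma con_coord {ι : Type*} [DecidableEq ι] (b : Module.Basis ι k W) (t : V ⊗[k] W) (i : ι) :
    con (b.coord i) t = TensorProduct.equivFinsuppOfBasisRight b t i := by
  rw [TensorProduct.equivFinsuppOfBasisRight_apply]; rfl

lemma con_sum {ι : Type*} [DecidableEq ι] (b : Module.Basis ι k W) (t : V ⊗[k] W) (s : Finset ι)
    (hs : (TensorProduct.equivFinsuppOfBasisRight b t).support ⊆ s) :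
    ∑ i ∈ s, con (b.coord i) t ⊗ₜ[k] b i = t := by
  conv_rhs => rw [← (TensorProduct.equivFinsuppOfBasisRight b).symm_apply_apply t]
  rw [TensorProduct.equivFinsuppOfBasisRight_symm_apply]
  rw [Finsupp.sum_of_support_subset _ hs _ (by simp)]
  simp [con_coord]

lemma con_ext {t t' : V ⊗[k] W} (h : ∀ φ : W →ₗ[k] k, con φ t = con φ t') : t = t' := by
  classical
  apply (TensorProduct.equivFinsuppOfBasisRight (Module.Basis.ofVectorSpace k W)).injective
  ext i
  rw [← con_coord, ← con_coord, h]

lemma joint_inj {ι : Type*} (e : ι → V →ₗ[k] V') (he : ∀ v v', (∀ i, e i v = e i v') → v = v')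
    {t t' : V ⊗[k] W} (h : ∀ i, LinearMap.rTensor W (e i) t = LinearMap.rTensor W (e i) t') :
    t = t' := by
  apply con_ext
  intro φ
  apply he
  intro i
  rw [← con_nat, ← con_nat, h]

lemma mem_range_of_con (q : Submodule k V) (t : V ⊗[k] W)
    (h : ∀ φ : W →ₗ[k] k, con φ t ∈ q) : t ∈ LinearMap.range (LinearMap.rTensor W q.subtype) := by
  classical
  let b := Module.Basis.ofVectorSpace k W
  refine ⟨∑ i ∈ (TensorProduct.equivFinsuppOfBasisRight b t).support,
    (⟨con (b.coord i) t, h _⟩ : q) ⊗ₜ[k] b i, ?_⟩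
  conv_rhs => rw [← con_sum b t _ subset_rfl]
  simp

lemma con_mem_of_range (q : Submodule k V) (t : V ⊗[k] W)
    (h : t ∈ LinearMap.range (LinearMap.rTensor W q.subtype)) (φ : W →ₗ[k] k) : con φ t ∈ q := by
  obtain ⟨s, rfl⟩ := h
  rw [con_nat]
  exact (con φ s).2

end con

lemma comul4 : TensorProduct.map (comul (R := k) (A := H)) (comul (R := k) (A := H)) ∘ₗ comul =
    (TensorProduct.assoc k H H (H ⊗[k] H)).symm.toLinearMap ∘ₗ
      LinearMap.lTensor H ((TensorProduct.assoc k H H H).toLinearMap ∘ₗ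
        LinearMap.rTensor H comul ∘ₗ comul) ∘ₗ comul := by
  simp only [coassoc_simps]

lemma G_mul_comul : WithConv.toConv ((TensorProduct.map (antipode k) (antipode k)) ∘ₗ
      (TensorProduct.comm k H H).toLinearMap ∘ₗ comul (R := k) (A := H)) *
      WithConv.toConv (comul (R := k) (A := H)) = 1 := by
  let J : H ⊗[k] (H ⊗[k] (H ⊗[k] H)) →ₗ[k] H ⊗[k] H :=
    LinearMap.mul' k (H ⊗[k] H) ∘ₗ LinearMap.rTensor (H ⊗[k] H)
      (TensorProduct.map (antipode k) (antipode k) ∘ₗ (TensorProduct.comm k H H).toLinearMap) ∘ₗ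
      (TensorProduct.assoc k H H (H ⊗[k] H)).symm.toLinearMap
  have h1 : J ∘ₗ LinearMap.lTensor H ((TensorProduct.assoc k H H H).toLinearMap ∘ₗ
        LinearMap.rTensor H comul) = TensorProduct.mk k H H 1 ∘ₗ LinearMap.mul' k H ∘ₗ
          LinearMap.rTensor H (antipode k) ∘ₗ LinearMap.lTensor H
            ((TensorProduct.lid k H).toLinearMap ∘ₗ LinearMap.rTensor H counit) := by
    ext a b e
    have := congrArg (fun x => x ⊗ₜ[k] (antipode k a * e))
      (sum_antipode_mul_eq_smul (R := k) (ℛ k b))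
    simp only [TensorProduct.sum_tmul] at this
    simp only [AlgebraTensorModule.curry_apply, LinearMap.restrictScalars_self, curry_apply,
      LinearMap.coe_comp, Function.comp_apply, LinearMap.lTensor_tmul, LinearMap.rTensor_tmul]
    rw [← (ℛ k b).eq]
    simp [J, TensorProduct.sum_tmul, TensorProduct.tmul_sum]
    simpa [TensorProduct.smul_tmul'] using this
  apply WithConv.ext
  rw [LinearMap.convMul_def]
  ext c
  have e1 := LinearMap.congr_fun (comul4 (k := k) (H := H)) c
  have e2 : TensorProduct.map ((TensorProduct.map (antipode k) (antipode k)) ∘ₗ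
      (TensorProduct.comm k H H).toLinearMap ∘ₗ comul (R := k) (A := H)) (comul (R := k) (A := H)) =
      LinearMap.rTensor (H ⊗[k] H)
      (TensorProduct.map (antipode k) (antipode k) ∘ₗ (TensorProduct.comm k H H).toLinearMap) ∘ₗ
      TensorProduct.map (comul (R := k) (A := H)) (comul (R := k) (A := H)) := by
    rw [LinearMap.rTensor, ← TensorProduct.map_comp]; rfl
  have e3 : ((TensorProduct.lid k H).toLinearMap ∘ₗ LinearMap.rTensor H (counit (R := k))) ∘ₗ
      comul = LinearMap.id := by
    ext x; simp
  have e4 := LinearMap.congr_fun h1 (LinearMap.lTensor H (comul (R := k)) (comul (R := k) c))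
  simp only [LinearMap.comp_apply] at e1 e4
  rw [← LinearMap.comp_apply (LinearMap.lTensor H _), ← LinearMap.comp_apply (LinearMap.lTensor H _),
    ← LinearMap.lTensor_comp, ← LinearMap.lTensor_comp, e3, LinearMap.lTensor_id,
    LinearMap.id_apply, mul_antipode_rTensor_comul_apply] at e4
  simp only [WithConv.ofConv_toConv, e2, LinearMap.comp_apply, e1, LinearMap.convOne_def]
  refine e4.trans ?_
  simp [Algebra.algebraMap_eq_smul_one, Algebra.TensorProduct.one_def]

lemma comul_antipode (a : H) : comul (R := k) (antipode k a) =
    ∑ i ∈ (ℛ k a).index, antipode k ((ℛ k a).right i) ⊗ₜ[k] antipode k ((ℛ k a).left i) := by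
  have key : (WithConv.toConv ((TensorProduct.map (antipode k) (antipode k)) ∘ₗ
      (TensorProduct.comm k H H).toLinearMap ∘ₗ comul (R := k) (A := H))) =
      WithConv.toConv (comul (R := k) (A := H) ∘ₗ antipode k) := by
    apply left_inv_eq_right_inv (a := WithConv.toConv (comul (R := k) (A := H)))
    · exact G_mul_comul
    · exact LinearMap.comul_right_inv
  have := congrArg (fun f : WithConv (H →ₗ[k] H ⊗[k] H) => f.ofConv a) key
  simp only [LinearMap.comp_apply, WithConv.ofConv_toConv] at this
  rw [← this]
  conv_lhs => rw [← (ℛ k a).eq]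
  simp

end Helpers

section HomComod

open Coalgebra HopfAlgebra

variable {k H : Type} [Field k] [Ring H] [HopfAlgebra k H]

section maps
variable {X B : Type} [AddCommGroup X] [Module k X] [AddCommGroup B] [Module k B]

/-- `(b ⊗ h) ⊗ g ↦ b ⊗ h S(g)` -/
def mulS : (B ⊗[k] H) ⊗[k] H →ₗ[k] B ⊗[k] H :=
  LinearMap.lTensor B (LinearMap.mul' k H ∘ₗ LinearMap.lTensor H (antipode k)) ∘ₗ
    (TensorProduct.assoc k B H H).toLinearMap

/-- `(b ⊗ h) ⊗ g ↦ b ⊗ h g` -/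
def mulR : (B ⊗[k] H) ⊗[k] H →ₗ[k] B ⊗[k] H :=
  LinearMap.lTensor B (LinearMap.mul' k H) ∘ₗ (TensorProduct.assoc k B H H).toLinearMap

lemma mulS_tmul (u : B ⊗[k] H) (g : H) :
    mulS (u ⊗ₜ[k] g) = LinearMap.lTensor B (LinearMap.mulRight k (antipode k g)) u := by
  induction u with
  | zero => simp
  | tmul b h => simp [mulS]
  | add x y hx hy => simp [hx, hy, TensorProduct.add_tmul]

lemma mulR_tmul (u : B ⊗[k] H) (g : H) :
    mulR (u ⊗ₜ[k] g) = LinearMap.lTensor B (LinearMap.mulRight k g) u := by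
  induction u with
  | zero => simp
  | tmul b h => simp [mulR]
  | add x y hx hy => simp [hx, hy, TensorProduct.add_tmul]

/-- `x ↦ f(x₀)₀ ⊗ f(x₀)₁ S(x₁)` -/
def TT (ρX : X →ₗ[k] X ⊗[k] H) (ρB : B →ₗ[k] B ⊗[k] H) (f : X →ₗ[k] B) : X →ₗ[k] B ⊗[k] H :=
  mulS ∘ₗ LinearMap.rTensor H (ρB ∘ₗ f) ∘ₗ ρX

lemma con_counit_mulS (z : (B ⊗[k] H) ⊗[k] H) :
    con (counit (R := k) (A := H)) (mulS z) =
      con (counit (R := k) (A := H)) (con (counit (R := k) (A := H)) z) := by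
  induction z with
  | zero => simp
  | add x y hx hy => simp [hx, hy]
  | tmul u g =>
    induction u with
    | zero => simp
    | add x y hx hy => simp only [TensorProduct.add_tmul, map_add, hx, hy]
    | tmul b h => simp [mulS_tmul, con_tmul, smul_smul, mul_comm]

lemma comod_counit {ρX : X →ₗ[k] X ⊗[k] H} (hX : IsComod k H ρX) (x : X) :
    con (counit (R := k) (A := H)) (ρX x) = x := hX.1 x

lemma con_counit_TT {ρX : X →ₗ[k] X ⊗[k] H} {ρB : B →ₗ[k] B ⊗[k] H} (hX : IsComod k H ρX)
    (hB : IsComod k H ρB) (f : X →ₗ[k] B) (x : X) :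
    con (counit (R := k) (A := H)) (TT ρX ρB f x) = f x := by
  simp only [TT, LinearMap.comp_apply]
  rw [con_counit_mulS, con_nat, LinearMap.comp_apply, comod_counit hX, comod_counit hB]

lemma coassoc' {ρX : X →ₗ[k] X ⊗[k] H} (hX : IsComod k H ρX) (x : X) :
    LinearMap.rTensor H ρX (ρX x) =
      (TensorProduct.assoc k X H H).symm (LinearMap.lTensor X (comul (R := k)) (ρX x)) := by
  rw [← hX.2 x, LinearEquiv.symm_apply_apply]

/-- `u ⊗ a ↦ ρ(u₀)(1 ⊗ S a) ⊗ u₁` -/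
def NN (ρB : B →ₗ[k] B ⊗[k] H) : (B ⊗[k] H) ⊗[k] H →ₗ[k] B ⊗[k] (H ⊗[k] H) :=
  (TensorProduct.assoc k B H H).toLinearMap ∘ₗ LinearMap.rTensor H mulS ∘ₗ
    (TensorProduct.rightComm k (B ⊗[k] H) H H).toLinearMap ∘ₗ
    LinearMap.rTensor H (LinearMap.rTensor H ρB)

lemma NN_tmul (ρB : B →ₗ[k] B ⊗[k] H) (u : B ⊗[k] H) (a : H) : NN ρB (u ⊗ₜ[k] a) =
    TensorProduct.assoc k B H H (LinearMap.rTensor H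
      (LinearMap.lTensor B (LinearMap.mulRight k (antipode k a)) ∘ₗ ρB) u) := by
  induction u with
  | zero => simp
  | add x y hx hy => simp only [TensorProduct.add_tmul, map_add, hx, hy]
  | tmul b h => simp [NN, mulS_tmul]

lemma assoc_aux (p q : H →ₗ[k] H) (ρB : B →ₗ[k] B ⊗[k] H) (u : B ⊗[k] H) :
    TensorProduct.assoc k B H H (LinearMap.rTensor H (LinearMap.lTensor B p ∘ₗ ρB)
      (LinearMap.lTensor B q u)) = LinearMap.lTensor B (TensorProduct.map p q)
        (TensorProduct.assoc k B H H (LinearMap.rTensor H ρB u)) := by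
  induction u with
  | zero => simp
  | add x y hx hy => simp only [map_add, hx, hy]
  | tmul b h =>
    simp only [LinearMap.lTensor_tmul, LinearMap.rTensor_tmul, LinearMap.comp_apply]
    generalize ρB b = v
    induction v with
    | zero => simp
    | add x y hx hy => simp only [TensorProduct.add_tmul, map_add, hx, hy]
    | tmul b h => simp

lemma key_assoc {ρB : B →ₗ[k] B ⊗[k] H} (hB : IsComod k H ρB) (c : B) (a : H) :
    ∑ i ∈ (ℛ k a).index, NN ρB (mulS (ρB c ⊗ₜ[k] (ℛ k a).left i) ⊗ₜ[k] (ℛ k a).right i) =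
      LinearMap.lTensor B (comul (R := k)) (mulS (ρB c ⊗ₜ[k] a)) := by
  simp only [mulS_tmul, NN_tmul, assoc_aux, hB.2]
  generalize ρB c = v
  induction v with
  | zero => simp
  | add x y hx hy => simp only [map_add, Finset.sum_add_distrib, hx, hy]
  | tmul b h =>
    simp only [LinearMap.lTensor_tmul, LinearMap.mulRight_apply, Bialgebra.comul_mul,
      comul_antipode, ← TensorProduct.tmul_sum]
    congr 1
    rw [Finset.mul_sum]
    refine Finset.sum_congr rfl fun i _ => ?_
    generalize comul (R := k) h = w
    induction w with
    | zero => simp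
    | add x y hx hy => simp only [map_add, add_mul, hx, hy]
    | tmul b h => simp

lemma TT_rTensor {ρX : X →ₗ[k] X ⊗[k] H} {ρB : B →ₗ[k] B ⊗[k] H} (hX : IsComod k H ρX)
    (f : X →ₗ[k] B) (x : X) : LinearMap.rTensor H (TT ρX ρB f) (ρX x) =
      LinearMap.rTensor H (mulS ∘ₗ LinearMap.rTensor H (ρB ∘ₗ f))
        ((TensorProduct.assoc k X H H).symm (LinearMap.lTensor X (comul (R := k)) (ρX x))) := by
  rw [← coassoc' hX]
  exact LinearMap.rTensor_comp_apply H (mulS ∘ₗ LinearMap.rTensor H (ρB ∘ₗ f)) ρX (ρX x)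

lemma NN_TT {ρX : X →ₗ[k] X ⊗[k] H} {ρB : B →ₗ[k] B ⊗[k] H} (hX : IsComod k H ρX)
    (hB : IsComod k H ρB) (f : X →ₗ[k] B) (x : X) :
    NN ρB (LinearMap.rTensor H (TT ρX ρB f) (ρX x)) =
      LinearMap.lTensor B (comul (R := k)) (TT ρX ρB f x) := by
  rw [TT_rTensor hX]
  simp only [TT, LinearMap.comp_apply]
  generalize ρX x = z
  induction z with
  | zero => simp
  | add x y hx hy => simp only [map_add, hx, hy]
  | tmul y a =>
    simp only [LinearMap.lTensor_tmul, LinearMap.rTensor_tmul, LinearMap.comp_apply]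
    rw [← key_assoc hB]
    conv_lhs => rw [← (ℛ k a).eq]
    simp [TensorProduct.tmul_sum]

lemma hom_of_TT {ρX : X →ₗ[k] X ⊗[k] H} {ρB : B →ₗ[k] B ⊗[k] H} (hX : IsComod k H ρX)
    (f : X →ₗ[k] B) (hf : ∀ x, TT ρX ρB f x = f x ⊗ₜ[k] (1 : H)) :
    ρB ∘ₗ f = LinearMap.rTensor H f ∘ₗ ρX := by
  ext x
  have h1 : mulR (LinearMap.rTensor H (TT ρX ρB f) (ρX x)) = LinearMap.rTensor H f (ρX x) := by
    generalize ρX x = z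
    induction z with
    | zero => simp
    | add x y hx hy => simp only [map_add, hx, hy]
    | tmul y a => simp [hf, mulR_tmul]
  have h2 : ∀ z : X ⊗[k] H, mulR (LinearMap.rTensor H (mulS ∘ₗ LinearMap.rTensor H (ρB ∘ₗ f))
        ((TensorProduct.assoc k X H H).symm (LinearMap.lTensor X (comul (R := k)) z))) =
      ρB (f (con (counit (R := k)) z)) := by
    intro z
    induction z with
    | zero => simp
    | add x y hx hy => simp only [map_add, hx, hy]
    | tmul y a =>
      rw [LinearMap.lTensor_tmul, ← (ℛ k a).eq]
      simp only [TensorProduct.tmul_sum, map_sum, TensorProduct.assoc_symm_tmul,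
        LinearMap.rTensor_tmul, LinearMap.comp_apply, mulS_tmul, mulR_tmul, con_tmul, map_smul]
      generalize ρB (f y) = v
      induction v with
      | zero => simp
      | add x y hx hy => simp only [map_add, Finset.sum_add_distrib, hx, hy, smul_add]
      | tmul b h =>
        simp only [LinearMap.lTensor_tmul, LinearMap.mulRight_apply, mul_assoc,
          ← TensorProduct.tmul_sum, ← Finset.mul_sum, sum_antipode_mul_eq_smul]
        simp
  rw [LinearMap.comp_apply, LinearMap.comp_apply, ← h1, TT_rTensor hX, h2, comod_counit hX]

lemma TT_id {ρX : X →ₗ[k] X ⊗[k] H} (hX : IsComod k H ρX) (x : X) :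
    TT ρX ρX LinearMap.id x = x ⊗ₜ[k] (1 : H) := by
  simp only [TT, LinearMap.comp_apply, LinearMap.comp_id]
  rw [coassoc' hX]
  have h2 : ∀ z : X ⊗[k] H, mulS
        ((TensorProduct.assoc k X H H).symm (LinearMap.lTensor X (comul (R := k)) z)) =
      (con (counit (R := k)) z) ⊗ₜ[k] (1 : H) := by
    intro z
    induction z with
    | zero => simp
    | add x y hx hy => simp only [map_add, hx, hy, TensorProduct.add_tmul]
    | tmul y a =>
      rw [LinearMap.lTensor_tmul, ← (ℛ k a).eq]
      simp only [TensorProduct.tmul_sum, map_sum, TensorProduct.assoc_symm_tmul,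
        LinearMap.lTensor_tmul, mulS_tmul, con_tmul, LinearMap.mulRight_apply]
      rw [← TensorProduct.tmul_sum, sum_mul_antipode_eq_smul]
      simp [TensorProduct.smul_tmul]
  rw [h2, comod_counit hX]

lemma TT_comp {C : Type} [AddCommGroup C] [Module k C] {ρX : X →ₗ[k] X ⊗[k] H}
    {ρB : B →ₗ[k] B ⊗[k] H} {ρC : C →ₗ[k] C ⊗[k] H} (g : B →ₗ[k] C) (hg : IsColin k H ρB ρC g)
    (f : X →ₗ[k] B) (x : X) :
    TT ρX ρC (g ∘ₗ f) x = LinearMap.rTensor H g (TT ρX ρB f x) := by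
  simp only [TT, LinearMap.comp_apply]
  generalize ρX x = z
  induction z with
  | zero => simp
  | add x y hx hy => simp only [map_add, hx, hy]
  | tmul y a =>
    have := LinearMap.congr_fun hg (f y)
    simp only [LinearMap.comp_apply] at this
    simp only [LinearMap.rTensor_tmul, LinearMap.comp_apply, mulS_tmul, this]
    generalize ρB (f y) = v
    induction v with
    | zero => simp
    | add x y hx hy => simp only [map_add, hx, hy]
    | tmul b h => simp

end maps

lemma evalAtH_apply {M N : Type} [AddCommGroup M] [Module k M] [Module H M]
    [IsScalarTower k H M] [SMulCommClass H k M] [AddCommGroup N] [Module k N] [Module H N]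
    [IsScalarTower k H N] [SMulCommClass H k N] (m : M) (f : M →ₗ[H] N) :
    evalAtH (k := k) m f = f m := rfl

lemma smulMap_apply' {M : Type} [AddCommGroup M] [Module k M] [Module H M]
    [SMulCommClass H k M] (h : H) (m : M) : smulMap k H h m = h • m := rfl

lemma eval_ext {M N W : Type} [AddCommGroup M] [Module k M] [Module H M]
    [IsScalarTower k H M] [SMulCommClass H k M] [AddCommGroup N] [Module k N] [Module H N]
    [IsScalarTower k H N] [SMulCommClass H k N] [AddCommGroup W] [Module k W]
    {t t' : (M →ₗ[H] N) ⊗[k] W}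
    (h : ∀ x : M, LinearMap.rTensor W (evalAtH x) t = LinearMap.rTensor W (evalAtH x) t') :
    t = t' :=
  joint_inj (fun x : M => evalAtH (k := k) (N := N) x) (fun v v' hv => by ext x; exact hv x) h

lemma exists_tensor {M N : Type} [AddCommGroup M] [Module k M] [Module H M]
    [IsScalarTower k H M] [SMulCommClass H k M] [AddCommGroup N] [Module k N] [Module H N]
    [IsScalarTower k H N] [SMulCommClass H k N] [Module.Finite H M]
    (F : M →ₗ[k] N ⊗[k] H)
    (hF : ∀ (h : H) (x : M), F (h • x) = LinearMap.rTensor H (smulMap k H h) (F x)) :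
    ∃ t : (M →ₗ[H] N) ⊗[k] H, ∀ x : M, LinearMap.rTensor H (evalAtH x) t = F x := by
  classical
  obtain ⟨S, hS⟩ := Module.Finite.fg_top (R := H) (M := M)
  let b := Module.Basis.ofVectorSpace k H
  let D := S.biUnion fun x => (TensorProduct.equivFinsuppOfBasisRight b (F x)).support
  let g := fun i => ({ toFun := fun x => con (b.coord i) (F x)
                       map_add' := fun x y => by simp
                       map_smul' := fun h x => by
                        rw [hF, con_nat]; rfl } : M →ₗ[H] N)
  refine ⟨∑ i ∈ D, g i ⊗ₜ[k] b i, fun x => ?_⟩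
  have e : ∀ x, LinearMap.rTensor H (evalAtH x) (∑ i ∈ D, g i ⊗ₜ[k] b i) =
      ∑ i ∈ D, con (b.coord i) (F x) ⊗ₜ[k] b i := by
    intro x
    simp only [map_sum, LinearMap.rTensor_tmul]
    rfl
  rw [e]
  have hx : x ∈ Submodule.span H (S : Set M) := by rw [hS]; trivial
  induction hx using Submodule.span_induction with
  | mem x hx =>
    exact con_sum b _ _ (Finset.subset_biUnion_of_mem
      (fun x => (TensorProduct.equivFinsuppOfBasisRight b (F x)).support) hx)
  | zero => simp
  | add x y _ _ hx hy => simp only [map_add, TensorProduct.add_tmul, Finset.sum_add_distrib, hx, hy]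
  | smul h x _ hx =>
    rw [hF]
    conv_rhs => rw [← hx]
    simp only [con_nat, map_sum, LinearMap.rTensor_tmul]

lemma TT_smul (X B : LongCat k H) (f : X.M →ₗ[H] B.M) (h : H) (x : X.M) :
    TT X.ρ B.ρ (f.restrictScalars k) (h • x) =
      LinearMap.rTensor H (smulMap k H h) (TT X.ρ B.ρ (f.restrictScalars k) x) := by
  simp only [TT, LinearMap.comp_apply, X.compat h x]
  generalize X.ρ x = z
  induction z with
  | zero => simp
  | add x y hx hy => simp only [map_add, hx, hy]
  | tmul y a =>
    simp only [LinearMap.rTensor_tmul, LinearMap.comp_apply, smulMap_apply',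
      LinearMap.coe_restrictScalars, map_smul, B.compat h, mulS_tmul]
    generalize B.ρ (f y) = v
    induction v with
    | zero => simp
    | add x y hx hy => simp only [map_add, hx, hy]
    | tmul b h => simp

lemma exists_homComod (X B : LongCat k H) (hX : Module.Finite H X.M) :
    ∃ ρQ : (X.M →ₗ[H] B.M) →ₗ[k] (X.M →ₗ[H] B.M) ⊗[k] H, IsComod k H ρQ ∧
      ∀ f x, LinearMap.rTensor H (evalAtH x) (ρQ f) = TT X.ρ B.ρ (f.restrictScalars k) x := by
  choose r hr using fun f : X.M →ₗ[H] B.M =>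
    exists_tensor (TT X.ρ B.ρ (f.restrictScalars k)) (TT_smul X B f)
  let ρQ : (X.M →ₗ[H] B.M) →ₗ[k] (X.M →ₗ[H] B.M) ⊗[k] H :=
    { toFun := r
      map_add' := fun f g => by
        apply eval_ext
        intro x
        rw [map_add, hr, hr, hr]
        have : (f + g).restrictScalars k = f.restrictScalars k + g.restrictScalars k := rfl
        rw [this]
        simp only [TT, LinearMap.comp_add, LinearMap.rTensor_add, LinearMap.add_comp,
          LinearMap.add_apply]
      map_smul' := fun c f => by
        apply eval_ext
        intro x
        rw [map_smul, hr, hr]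
        have : (c • f).restrictScalars k = c • f.restrictScalars k := rfl
        rw [this]
        simp only [TT, LinearMap.comp_smul, LinearMap.rTensor_smul, LinearMap.smul_comp,
          LinearMap.smul_apply, RingHom.id_apply] }
  have hρ : ∀ f x, LinearMap.rTensor H (evalAtH x) (ρQ f) =
    TT X.ρ B.ρ (f.restrictScalars k) x := hr
  refine ⟨ρQ, ⟨fun f => ?_, fun f => ?_⟩, hρ⟩
  · ext x
    change evalAtH (k := k) x (con _ (ρQ f)) = _
    rw [← con_nat, hρ, con_counit_TT X.comod B.comod]
    rfl
  · apply eval_ext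
    intro x
    have e1 : LinearMap.rTensor (H ⊗[k] H) (evalAtH (k := k) (N := B.M) x)
        (LinearMap.lTensor _ (Coalgebra.comul (R := k)) (ρQ f)) =
        LinearMap.lTensor _ (Coalgebra.comul (R := k))
          (LinearMap.rTensor H (evalAtH (k := k) (N := B.M) x) (ρQ f)) := by
      generalize ρQ f = z
      induction z with
      | zero => simp
      | add x y hx hy => simp only [map_add, hx, hy]
      | tmul y a => simp
    have e2 : ∀ t, LinearMap.rTensor (H ⊗[k] H) (evalAtH (k := k) (N := B.M) x)
        (TensorProduct.assoc k _ H H (LinearMap.rTensor H ρQ t)) =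
        TensorProduct.assoc k _ H H (LinearMap.rTensor H
          (LinearMap.rTensor H (evalAtH (k := k) (N := B.M) x) ∘ₗ ρQ) t) := by
      intro t
      induction t with
      | zero => simp
      | add x y hx hy => simp only [map_add, hx, hy]
      | tmul y a =>
        simp only [LinearMap.rTensor_tmul, LinearMap.comp_apply]
        generalize ρQ y = v
        induction v with
        | zero => simp
        | add x y hx hy => simp only [map_add, TensorProduct.add_tmul, hx, hy]
        | tmul b h => simp
    rw [e1, hρ, e2, ← NN_TT X.comod B.comod]
    have e3 : ∀ z : X.M ⊗[k] H, ∀ L : (X.M →ₗ[H] B.M) →ₗ[k] B.M ⊗[k] H,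
        (∀ g, L g = mulS (LinearMap.rTensor H (B.ρ ∘ₗ g.restrictScalars k) z)) →
        TensorProduct.assoc k _ H H (LinearMap.rTensor H L (ρQ f)) =
        NN B.ρ (LinearMap.rTensor H (TT X.ρ B.ρ (f.restrictScalars k)) z) := by
      intro z
      induction z with
      | zero =>
        intro L hL
        have : L = 0 := by ext g; simp [hL]
        simp [this]
      | add z w hz hw =>
        intro L hL
        let LL : X.M ⊗[k] H → (X.M →ₗ[H] B.M) →ₗ[k] B.M ⊗[k] H := fun z =>
          { toFun := fun g => mulS (LinearMap.rTensor H (B.ρ ∘ₗ g.restrictScalars k) z)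
            map_add' := fun f g => by
              have : (f + g).restrictScalars k = f.restrictScalars k + g.restrictScalars k := rfl
              rw [this]
              simp only [LinearMap.comp_add, LinearMap.rTensor_add, LinearMap.add_apply, map_add]
            map_smul' := fun c f => by
              have : (c • f).restrictScalars k = c • f.restrictScalars k := rfl
              rw [this]
              simp only [LinearMap.comp_smul, LinearMap.rTensor_smul, LinearMap.smul_apply,
                map_smul, RingHom.id_apply] }
        have : L = LL z + LL w := by
          ext g
          rw [hL, map_add, map_add]
          rfl
        rw [this, LinearMap.rTensor_add, LinearMap.add_apply, map_add, hz (LL z) (fun _ => rfl),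
          hw (LL w) (fun _ => rfl), map_add, map_add]
      | tmul y a =>
        intro L hL
        have : L = (LinearMap.lTensor B.M (LinearMap.mulRight k (antipode k a)) ∘ₗ B.ρ) ∘ₗ
            evalAtH (k := k) (N := B.M) y := by
          ext g
          rw [hL, LinearMap.rTensor_tmul, mulS_tmul]
          rfl
        rw [this, LinearMap.rTensor_comp_apply, hρ, LinearMap.rTensor_tmul, NN_tmul]
    exact e3 _ _ fun g => hρ g x

end HomComod

section Compl

open Coalgebra HopfAlgebra

variable {k H : Type} [Field k] [Ring H] [HopfAlgebra k H]

lemma assoc_nat {P A : Type} [AddCommGroup P] [Module k P] [AddCommGroup A] [Module k A]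
    {V : Type} [AddCommGroup V] [Module k V]
    (e : P →ₗ[k] A) (r : V →ₗ[k] P ⊗[k] H) (t : V ⊗[k] H) :
    LinearMap.rTensor (H ⊗[k] H) e (TensorProduct.assoc k P H H (LinearMap.rTensor H r t)) =
      TensorProduct.assoc k A H H (LinearMap.rTensor H (LinearMap.rTensor H e ∘ₗ r) t) := by
  induction t with
  | zero => simp
  | add x y hx hy => simp only [map_add, hx, hy]
  | tmul y a =>
    simp only [LinearMap.rTensor_tmul, LinearMap.comp_apply]
    generalize r y = v
    induction v with
    | zero => simp
    | add x y hx hy => simp only [map_add, TensorProduct.add_tmul, hx, hy]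
    | tmul b h => simp

lemma comul_nat {P A : Type} [AddCommGroup P] [Module k P] [AddCommGroup A] [Module k A]
    (e : P →ₗ[k] A) (t : P ⊗[k] H) :
    LinearMap.rTensor (H ⊗[k] H) e (LinearMap.lTensor P (comul (R := k)) t) =
      LinearMap.lTensor A (comul (R := k)) (LinearMap.rTensor H e t) := by
  induction t with
  | zero => simp
  | add x y hx hy => simp only [map_add, hx, hy]
  | tmul y a => simp

lemma exists_sub (A : LongCat k H) {P : Type} [AddCommGroup P] [Module k P] [Module H P]
    [IsScalarTower k H P] [SMulCommClass H k P] (e : P →ₗ[k] A.M) (he : Function.Injective e)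
    (hH : ∀ (h : H) x, e (h • x) = h • e x)
    (hr : ∀ x (φ : H →ₗ[k] k), ∃ y, e y = con φ (A.ρ (e x))) :
    ∃ ρP : P →ₗ[k] P ⊗[k] H, IsComod k H ρP ∧ IsLongCompat k H ρP ∧ IsHom k H ρP A.ρ e := by
  obtain ⟨r, hre⟩ := LinearMap.exists_leftInverse_of_injective e (LinearMap.ker_eq_bot.2 he)
  have hre' : ∀ x, r (e x) = x := fun x => LinearMap.congr_fun hre x
  let ρP : P →ₗ[k] P ⊗[k] H := LinearMap.rTensor H r ∘ₗ A.ρ ∘ₗ e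
  have key : ∀ x, LinearMap.rTensor H e (ρP x) = A.ρ (e x) := by
    intro x
    apply con_ext
    intro φ
    obtain ⟨y, hy⟩ := hr x φ
    rw [con_nat]
    simp only [ρP, LinearMap.comp_apply]
    rw [con_nat, ← hy, hre']
  have inj : ∀ (W : Type) [AddCommGroup W] [Module k W] (t t' : P ⊗[k] W),
      LinearMap.rTensor W e t = LinearMap.rTensor W e t' → t = t' := by
    intro W _ _ t t' h
    exact joint_inj (fun _ : Unit => e) (fun v v' hv => he (hv ())) (fun _ => h)
  have hc : A.ρ ∘ₗ e = LinearMap.rTensor H e ∘ₗ ρP := by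
    ext x; exact (key x).symm
  refine ⟨ρP, ⟨fun x => ?_, fun x => ?_⟩, fun h x => ?_, hH, hc⟩
  · change con counit (ρP x) = x
    apply he
    rw [← con_nat, key, comod_counit A.comod]
  · apply inj
    rw [assoc_nat, ← hc, LinearMap.rTensor_comp_apply, key, comul_nat, key, A.comod.2]
  · apply inj
    rw [key, hH, A.compat, ← key, ← LinearMap.rTensor_comp_apply, ← LinearMap.rTensor_comp_apply]
    congr 2
    ext x
    simp [smulMap_apply', hH]

lemma exists_quot (A : LongCat k H) {Q : Type} [AddCommGroup Q] [Module k Q] [Module H Q]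
    [IsScalarTower k H Q] [SMulCommClass H k Q] (g : A.M →ₗ[k] Q) (hg : Function.Surjective g)
    (hH : ∀ (h : H) x, g (h • x) = h • g x)
    (hr : ∀ x, g x = 0 → ∀ (φ : H →ₗ[k] k), g (con φ (A.ρ x)) = 0) :
    ∃ ρQ : Q →ₗ[k] Q ⊗[k] H, IsComod k H ρQ ∧ IsLongCompat k H ρQ ∧ IsHom k H A.ρ ρQ g := by
  obtain ⟨s, hs⟩ := LinearMap.exists_rightInverse_of_surjective g (LinearMap.range_eq_top.2 hg)
  have hs' : ∀ x, g (s x) = x := fun x => LinearMap.congr_fun hs x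
  let ρQ : Q →ₗ[k] Q ⊗[k] H := LinearMap.rTensor H g ∘ₗ A.ρ ∘ₗ s
  have key : ∀ x, ρQ (g x) = LinearMap.rTensor H g (A.ρ x) := by
    intro x
    apply con_ext
    intro φ
    simp only [ρQ, LinearMap.comp_apply]
    rw [con_nat, con_nat, ← sub_eq_zero, ← map_sub, ← map_sub, ← map_sub]
    apply hr
    rw [map_sub, hs', sub_self]
  have hc : ρQ ∘ₗ g = LinearMap.rTensor H g ∘ₗ A.ρ := by
    ext x; exact key x
  refine ⟨ρQ, ⟨fun x => ?_, fun x => ?_⟩, fun h x => ?_, hH, hc⟩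
  · change con counit (ρQ x) = x
    obtain ⟨a, rfl⟩ := hg x
    rw [key, con_nat, comod_counit A.comod]
  · obtain ⟨a, rfl⟩ := hg x
    rw [key, ← LinearMap.rTensor_comp_apply, hc, ← assoc_nat, A.comod.2, comul_nat]
  · obtain ⟨a, rfl⟩ := hg x
    rw [← hH, key, key, A.compat, ← LinearMap.rTensor_comp_apply, ← LinearMap.rTensor_comp_apply]
    congr 2
    ext x
    simp [smulMap_apply', hH]

lemma con_smul (A : LongCat k H) (φ : H →ₗ[k] k) (h : H) (m : A.M) :
    con φ (A.ρ (h • m)) = h • con φ (A.ρ m) := by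
  rw [A.compat, con_nat, smulMap_apply']

lemma isSubobject_iff (A : LongCat k H) (p : Submodule H A.M) :
    IsSubobject A.ρ p ↔ ∀ m ∈ p, ∀ φ : H →ₗ[k] k, con φ (A.ρ m) ∈ p :=
  ⟨fun h m hm φ => con_mem_of_range (p.restrictScalars k) _ (h m hm) φ,
   fun h m hm => mem_range_of_con (p.restrictScalars k) _ (h m hm)⟩

lemma exists_compl (hdagger : DaggerLong k H) (hcoinv : CoinvExactComod k H)
    (A : LongCat k H) (hA : Module.Finite H A.M) (p : Submodule H A.M) (hp : IsSubobject A.ρ p) :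
    ∃ q : Submodule H A.M, IsSubobject A.ρ q ∧ IsCompl p q := by
  rw [isSubobject_iff] at hp
  let e : ↥p →ₗ[k] A.M := p.subtype.restrictScalars k
  let g : A.M →ₗ[k] A.M ⧸ p := p.mkQ.restrictScalars k
  have hg : Function.Surjective g := p.mkQ_surjective
  haveI : SMulCommClass H k ↥p := ⟨fun h c x => by ext; exact smul_comm h c (x : A.M)⟩
  haveI : SMulCommClass H k (A.M ⧸ p) := ⟨fun h c x => by
    obtain ⟨x, rfl⟩ := p.mkQ_surjective x
    exact congrArg p.mkQ (smul_comm h c x)⟩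
  obtain ⟨ρP, hP1, hP2, he⟩ := exists_sub A e (Subtype.val_injective) (fun h x => rfl)
    (fun x φ => ⟨⟨_, hp x x.2 φ⟩, rfl⟩)
  obtain ⟨ρQ, hQ1, hQ2, hgh⟩ := exists_quot A g hg (fun h x => rfl) (fun x hx φ => by
    have hx' : x ∈ p := (Submodule.Quotient.mk_eq_zero p).1 hx
    exact (Submodule.Quotient.mk_eq_zero p).2 (hp x hx' φ))
  let P : LongCat k H := { M := ↥p, ρ := ρP, comod := hP1, compat := hP2 }
  let Q : LongCat k H := { M := A.M ⧸ p, ρ := ρQ, comod := hQ1, compat := hQ2 }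
  have hQf : Module.Finite H Q.M := inferInstanceAs (Module.Finite H (A.M ⧸ p))
  have hex : LinearMap.range e = LinearMap.ker g := by
    ext x
    constructor
    · rintro ⟨y, rfl⟩
      exact (Submodule.Quotient.mk_eq_zero p).2 y.2
    · intro hx
      exact ⟨⟨x, (Submodule.Quotient.mk_eq_zero p).1 hx⟩, rfl⟩
  have hd := hdagger Q hQf P A Q e g he hgh Subtype.val_injective hg hex
  obtain ⟨r1, c1, t1⟩ := exists_homComod Q P hQf
  obtain ⟨r2, c2, t2⟩ := exists_homComod Q A hQf
  obtain ⟨r3, c3, t3⟩ := exists_homComod Q Q hQf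
  have colin : ∀ (B C : LongCat k H) (rB : (Q.M →ₗ[H] B.M) →ₗ[k] (Q.M →ₗ[H] B.M) ⊗[k] H)
      (rC : (Q.M →ₗ[H] C.M) →ₗ[k] (Q.M →ₗ[H] C.M) ⊗[k] H)
      (_ : ∀ f x, LinearMap.rTensor H (evalAtH x) (rB f) = TT Q.ρ B.ρ (f.restrictScalars k) x)
      (_ : ∀ f x, LinearMap.rTensor H (evalAtH x) (rC f) = TT Q.ρ C.ρ (f.restrictScalars k) x)
      (u : B.M →ₗ[k] C.M) (hu : IsHom k H B.ρ C.ρ u),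
      IsColin k H rB rC (postcompH (X := Q.M) u hu.1) := by
    intro B C rB rC hB hC u hu
    ext f : 1
    apply eval_ext
    intro x
    rw [LinearMap.comp_apply, LinearMap.comp_apply, hC, ← LinearMap.rTensor_comp_apply]
    have e1 : (postcompH (X := Q.M) u hu.1 f).restrictScalars k = u ∘ₗ f.restrictScalars k := rfl
    have e2 : evalAtH (k := k) (N := C.M) x ∘ₗ (postcompH (X := Q.M) u hu.1) =
      u ∘ₗ evalAtH (k := k) (N := B.M) x := rfl
    rw [e1, e2, TT_comp u hu.2, LinearMap.rTensor_comp_apply, hB]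
  have hco := hcoinv ⟨_, r1, c1⟩ ⟨_, r2, c2⟩ ⟨_, r3, c3⟩ (postcompH (X := Q.M) e he.1)
    (postcompH (X := Q.M) g hgh.1) (colin P A r1 r2 t1 t2 e he) (colin A Q r2 r3 t2 t3 g hgh)
    hd.1 hd.2.2 hd.2.1
  have hid : (LinearMap.id : Q.M →ₗ[H] Q.M) ∈ coinv r3 := by
    rw [mem_coinv]
    apply eval_ext
    intro x
    rw [t3]
    exact TT_id Q.comod x
  obtain ⟨⟨s, hs⟩, hs'⟩ := hco.2.2 ⟨_, hid⟩
  have hsec : ∀ y : A.M ⧸ p, p.mkQ (s y) = y := fun y =>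
    LinearMap.congr_fun (congrArg Subtype.val hs') y
  have hscol := hom_of_TT Q.comod (ρB := A.ρ) (s.restrictScalars k) (fun x => by
    rw [← t2, mem_coinv.1 hs]
    rfl)
  refine ⟨LinearMap.range (s : (A.M ⧸ p) →ₗ[H] A.M), ?_, ?_⟩
  · rw [isSubobject_iff]
    rintro _ ⟨y, rfl⟩ φ
    refine ⟨con φ (Q.ρ y), ?_⟩
    have := LinearMap.congr_fun hscol y
    simp only [LinearMap.comp_apply] at this
    change _ = con φ (A.ρ (s.restrictScalars k y))
    rw [this, con_nat]
    rfl
  · constructor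
    · rw [Submodule.disjoint_def]
      rintro _ hx ⟨y, rfl⟩
      have := hsec y
      have h0 : p.mkQ (s y) = 0 := (Submodule.Quotient.mk_eq_zero p).2 hx
      rw [h0] at this
      rw [← this, map_zero]
    · rw [codisjoint_iff, eq_top_iff]
      intro x _
      rw [Submodule.mem_sup]
      refine ⟨x - s (p.mkQ x), ?_, s (p.mkQ x), ⟨_, rfl⟩, by abel⟩
      rw [← Submodule.Quotient.mk_eq_zero p]
      change p.mkQ _ = 0
      rw [map_sub, hsec, sub_self]

end Compl

section Semi

open Coalgebra HopfAlgebra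

variable {k H : Type} [Field k] [Ring H] [HopfAlgebra k H]

lemma con_con {X : Type} [AddCommGroup X] [Module k X] (φ ψ : H →ₗ[k] k) (t : X ⊗[k] H) :
    con φ (LinearMap.rTensor H (con ψ)
      ((TensorProduct.assoc k X H H).symm (LinearMap.lTensor X comul t))) =
    con (LinearMap.mul' k k ∘ₗ TensorProduct.map ψ φ ∘ₗ comul) t := by
  induction t with
  | zero => simp
  | add x y hx hy => simp only [map_add, hx, hy]
  | tmul x a =>
    rw [LinearMap.lTensor_tmul, con_tmul]
    simp only [LinearMap.comp_apply]
    induction comul (R := k) a with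
    | zero => simp
    | add u v hu hv => simp only [map_add, TensorProduct.tmul_add, add_smul, hu, hv]
    | tmul b c => simp [con_tmul, smul_smul, mul_comm]

lemma con_coact (A : LongCat k H) (φ ψ : H →ₗ[k] k) (m : A.M) :
    con ψ (A.ρ (con φ (A.ρ m))) =
      con (LinearMap.mul' k k ∘ₗ TensorProduct.map ψ φ ∘ₗ comul) (A.ρ m) := by
  rw [← con_con, ← coassoc' A.comod, ← LinearMap.comp_apply (con ψ) A.ρ, ← con_nat,
    LinearMap.rTensor_comp, LinearMap.comp_apply]

lemma exists_fg (hn : IsNoetherianRing H) (A : LongCat k H) (m : A.M) :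
    ∃ q : Submodule H A.M, m ∈ q ∧ q.FG ∧ ∀ x ∈ q, ∀ φ, con φ (A.ρ x) ∈ q := by
  classical
  obtain ⟨s, hs⟩ := TensorProduct.exists_finset (A.ρ m)
  have hfin : Module.Finite H (Submodule.span H ((s.image Prod.fst : Finset A.M) : Set A.M)) :=
    Module.Finite.span_finset _ _
  have hN : IsNoetherian H (Submodule.span H ((s.image Prod.fst : Finset A.M) : Set A.M)) :=
    isNoetherian_of_isNoetherianRing_of_finite _ _
  refine ⟨Submodule.span H (Set.range fun φ : H →ₗ[k] k => con φ (A.ρ m)), ?_, ?_, ?_⟩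
  · exact Submodule.subset_span ⟨counit, comod_counit A.comod m⟩
  · refine isNoetherian_submodule.1 hN _ (Submodule.span_le.2 ?_)
    rintro _ ⟨φ, rfl⟩
    simp only [hs, map_sum, con_tmul]
    refine Submodule.sum_mem _ fun i hi => ?_
    rw [← algebraMap_smul H]
    refine Submodule.smul_mem _ _ (Submodule.subset_span ?_)
    exact Finset.mem_coe.2 (Finset.mem_image_of_mem _ hi)
  · intro x hx φ
    induction hx using Submodule.span_induction with
    | mem x hx =>
      obtain ⟨ψ, rfl⟩ := hx
      simp only [con_coact]
      exact Submodule.subset_span ⟨_, rfl⟩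
    | zero => simp
    | add x y _ _ hx hy => simpa using Submodule.add_mem _ hx hy
    | smul a x _ hx => rw [con_smul]; exact Submodule.smul_mem _ _ hx

/-- The algebra of endomorphisms generated by the action and the coaction. -/
def LR (A : LongCat k H) : Subalgebra k (Module.End k A.M) :=
  Algebra.adjoin k (Set.range (fun h : H => (smulMap k H h : A.M →ₗ[k] A.M)) ∪
    Set.range (fun φ : H →ₗ[k] k => con φ ∘ₗ A.ρ))

/-- The generator of `LR A` given by the action of `h`. -/
def lrH (A : LongCat k H) (h : H) : LR A :=
  ⟨smulMap k H h, Algebra.subset_adjoin (Or.inl ⟨h, rfl⟩)⟩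

/-- The generator of `LR A` given by the contraction along `φ`. -/
def lrC (A : LongCat k H) (φ : H →ₗ[k] k) : LR A :=
  ⟨con φ ∘ₗ A.ρ, Algebra.subset_adjoin (Or.inr ⟨φ, rfl⟩)⟩

lemma lrH_smul (A : LongCat k H) (h : H) (m : A.M) : lrH A h • m = h • m := rfl

lemma lrC_smul (A : LongCat k H) (φ : H →ₗ[k] k) (m : A.M) :
    lrC A φ • m = con φ (A.ρ m) := rfl

instance lrSMul (A : LongCat k H) : SMul H (LR A) := ⟨fun h r => lrH A h * r⟩

instance lrTower (A : LongCat k H) : IsScalarTower H (LR A) A.M :=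
  ⟨fun h r m => by
    change (lrH A h * r) • m = _
    rw [mul_smul, lrH_smul]⟩

lemma lr_stable (A : LongCat k H) (q : Submodule H A.M)
    (hq : ∀ m ∈ q, ∀ φ, con φ (A.ρ m) ∈ q) (r : LR A) (m : A.M) (hm : m ∈ q) : r • m ∈ q := by
  obtain ⟨r, hr⟩ := r
  change r m ∈ q
  induction hr using Algebra.adjoin_induction generalizing m with
  | mem x hx =>
    rcases hx with ⟨h, rfl⟩ | ⟨φ, rfl⟩
    · exact q.smul_mem h hm
    · exact hq m hm φ
  | algebraMap c =>
    rw [Module.algebraMap_end_apply, ← algebraMap_smul H]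
    exact q.smul_mem _ hm
  | add x y _ _ hx hy => exact q.add_mem (hx m hm) (hy m hm)
  | mul x y _ _ hx hy => exact hx _ (hy m hm)

/-- A stable `H`-submodule as an `LR A`-submodule. -/
def lrSub (A : LongCat k H) (q : Submodule H A.M)
    (hq : ∀ m ∈ q, ∀ φ, con φ (A.ρ m) ∈ q) : Submodule (LR A) A.M where
  carrier := q
  add_mem' := q.add_mem
  zero_mem' := q.zero_mem
  smul_mem' r m hm := lr_stable A q hq r m hm

lemma lr_con (A : LongCat k H) (N : Submodule (LR A) A.M) (m : A.M) (hm : m ∈ N)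
    (φ : H →ₗ[k] k) : con φ (A.ρ m) ∈ N := N.smul_mem (lrC A φ) hm

lemma span_fg (hn : IsNoetherianRing H) (A : LongCat k H) (m : A.M) :
    ((Submodule.span (LR A) {m}).restrictScalars H).FG := by
  obtain ⟨q, hm, hfg, hq⟩ := exists_fg hn A m
  have hfin : Module.Finite H q := Module.Finite.iff_fg.2 hfg
  have hN : IsNoetherian H q := isNoetherian_of_isNoetherianRing_of_finite _ _
  refine isNoetherian_submodule.1 hN _ ?_
  intro x hx
  have : Submodule.span (LR A) {m} ≤ lrSub A q hq :=
    Submodule.span_le.2 (by simpa using (show m ∈ lrSub A q hq from hm))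
  exact this hx

lemma semisimple_of_fg (hdagger : DaggerLong k H) (hcoinv : CoinvExactComod k H)
    (A : LongCat k H) (F : Submodule (LR A) A.M) (hF : (F.restrictScalars H).FG) :
    IsSemisimpleModule (LR A) F := by
  let P := ↥(F.restrictScalars H)
  let e : P →ₗ[k] A.M := (F.restrictScalars H).subtype.restrictScalars k
  have he : Function.Injective e := Subtype.val_injective
  obtain ⟨ρP, h1, h2, h3⟩ := exists_sub A e he (fun h x => rfl)
    (fun x φ => ⟨⟨con φ (A.ρ x.1), lr_con A F _ x.2 φ⟩, rfl⟩)
  let B : LongCat k H := ⟨P, ρP, h1, h2⟩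
  have hBe : ∀ (x : P) φ, (con φ (ρP x) : P).1 = con φ (A.ρ x.1) := fun x φ => by
    have := LinearMap.congr_fun h3.2 x
    change e _ = con φ (A.ρ (e x))
    rw [← con_nat]
    exact congrArg (con φ) this.symm
  have hfin : Module.Finite H B.M := Module.Finite.iff_fg.2 hF
  refine (isSemisimpleModule_iff _ _).2 ⟨fun N => ?_⟩
  let p : Submodule H B.M :=
    { carrier := {x | (⟨x.1, x.2⟩ : F) ∈ N}
      add_mem' := fun hx hy => N.add_mem hx hy
      zero_mem' := N.zero_mem
      smul_mem' := fun h x hx => N.smul_mem (lrH A h) hx }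
  have hp : IsSubobject B.ρ p := (isSubobject_iff B p).2 fun m hm φ => by
    have : (lrC A φ) • (⟨m.1, m.2⟩ : F) ∈ N := N.smul_mem _ hm
    have h4 : (lrC A φ) • (⟨m.1, m.2⟩ : F) = ⟨(con φ (ρP m) : P).1, (con φ (ρP m) : P).2⟩ :=
      Subtype.ext (hBe m φ).symm
    rw [h4] at this
    exact this
  obtain ⟨q, hq, hpq⟩ := exists_compl hdagger hcoinv B hfin p hp
  have hq' := (isSubobject_iff B q).1 hq
  let q0 : Submodule H A.M := q.map (F.restrictScalars H).subtype
  have hq0 : ∀ m ∈ q0, ∀ φ, con φ (A.ρ m) ∈ q0 := by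
    rintro _ ⟨x, hx, rfl⟩ φ
    exact ⟨con φ (ρP x), hq' x hx φ, hBe x φ⟩
  refine ⟨(lrSub A q0 hq0).comap F.subtype, ?_⟩
  rw [isCompl_iff, disjoint_iff, codisjoint_iff, eq_bot_iff, eq_top_iff]
  constructor
  · rintro x ⟨hx1, y, hy, hyx⟩
    have hxy : y = (⟨x.1, x.2⟩ : P) := Subtype.ext hyx
    subst hxy
    have := hpq.1.le_bot (show _ ∈ p ⊓ q from ⟨hx1, hy⟩)
    exact Subtype.ext (congrArg Subtype.val ((Submodule.mem_bot H).1 this))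
  · intro x _
    have : (⟨x.1, x.2⟩ : P) ∈ p ⊔ q := by rw [hpq.sup_eq_top]; exact Submodule.mem_top
    obtain ⟨y, hy, z, hz, hyz⟩ := Submodule.mem_sup.1 this
    exact Submodule.mem_sup.2 ⟨⟨y.1, y.2⟩, hy, ⟨z.1, z.2⟩, ⟨z, hz, rfl⟩,
      Subtype.ext (congrArg Subtype.val hyz)⟩

lemma lr_semisimple (hn : IsNoetherianRing H) (hdagger : DaggerLong k H)
    (hcoinv : CoinvExactComod k H) (A : LongCat k H) : IsSemisimpleModule (LR A) A.M := by
  refine isSemisimpleModule_of_isSemisimpleModule_submodule'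
    (p := fun m : A.M => Submodule.span (LR A) {m})
    (fun m => semisimple_of_fg hdagger hcoinv A _ (span_fg hn A m)) ?_
  rw [eq_top_iff]
  intro m _
  exact (le_iSup (fun m : A.M => Submodule.span (LR A) {m}) m) (Submodule.mem_span_singleton_self m)

theorem semisimple_all (hn : IsNoetherianRing H) (hdagger : DaggerLong k H)
    (hcoinv : CoinvExactComod k H) (A : LongCat k H) : IsSemisimpleObj A.ρ := by
  have hss := lr_semisimple hn hdagger hcoinv A
  obtain ⟨s, hs, htop, hsimple⟩ :=
    IsSemisimpleModule.exists_sSupIndep_sSup_simples_eq_top (LR A) A.M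
  refine ⟨s, fun i => i.1.restrictScalars H, fun i => ⟨⟨?_, ?_, ?_⟩, ?_⟩, ?_, ?_⟩
  · exact (isSubobject_iff A _).2 fun m hm φ => lr_con A i.1 m hm φ
  · have := isSimpleModule_iff_isAtom.1 (hsimple i.1 i.2)
    intro h
    exact this.1 ((Submodule.restrictScalars_eq_bot_iff _ _ _).1 h)
  · intro q hq hle
    have hat := isSimpleModule_iff_isAtom.1 (hsimple i.1 i.2)
    have hq' := (isSubobject_iff A q).1 hq
    have h1 : lrSub A q hq' ≤ i.1 := hle
    rcases hat.le_iff.1 h1 with h | h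
    · left
      exact SetLike.ext fun x => (SetLike.ext_iff.1 h x).trans Iff.rfl
    · right
      exact SetLike.ext fun x => (SetLike.ext_iff.1 h x).trans Iff.rfl
  · have hat := isSimpleModule_iff_isAtom.1 (hsimple i.1 i.2)
    obtain ⟨m, hm, hm0⟩ := Submodule.exists_mem_ne_zero_of_ne_bot hat.1
    have h1 : Submodule.span (LR A) {m} ≤ i.1 := Submodule.span_le.2 (by simpa using hm)
    rcases hat.le_iff.1 h1 with h | h
    · exact absurd (Submodule.span_singleton_eq_bot.1 h) hm0
    · have := span_fg hn A m
      rwa [h] at this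
  · rw [sSupIndep_iff] at hs
    intro i
    have := hs i
    rw [disjoint_iff] at this ⊢
    have h2 := congrArg (Submodule.restrictScalarsLatticeHom H (LR A) A.M) this
    rw [map_inf, map_bot] at h2
    simp only [map_iSup] at h2
    exact h2
  · have h2 := congrArg (Submodule.restrictScalarsLatticeHom H (LR A) A.M) htop
    rw [sSup_eq_iSup', map_iSup, map_top] at h2
    exact h2

end Semi

/-- Corollary 3.7. Let `k` be a field and `H` a left noetherian
Hopf algebra over `k` with bijective antipode. If the category of Long dimodules
satisfies condition (†) and the coinvariants functor is exact on right
`H`-comodules, then every Long dimodule which is finitely generated as an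
`H`-module is a direct sum of simple subobjects finitely generated as `H`-modules,
and the category of Long dimodules is semisimple. -/
theorem Long_semisimple_of_dagger_and_coinvariants_exact
    (k H : Type) [Field k] [Ring H] [HopfAlgebra k H]
    (Sinv : H →ₗ[k] H)
    (hS1 : ∀ h : H, Sinv (HopfAlgebra.antipode (R := k) (A := H) h) = h)
    (hS2 : ∀ h : H, HopfAlgebra.antipode (R := k) (A := H) (Sinv h) = h)
    (hnoeth : IsNoetherianRing H)
    (hdagger : DaggerLong k H)
    (hcoinv : CoinvExactComod k H) :
    (∀ A : LongCat k H, Module.Finite H A.M → IsSemisimpleObj A.ρ) ∧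
    (∀ A : LongCat k H, IsSemisimpleObj A.ρ) := by
  have h := fun A : LongCat k H => semisimple_all hnoeth hdagger hcoinv A
  exact ⟨fun A _ => h A, h⟩
end YDPaper
end
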